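/- Let γ ∈ (−2,0), s > 2, ε > 0, and let f : ℝ³ → ℝ be measurable with 0 ≤ f ≤ ε⁻¹ and ∬_{ℝ³×ℝ³} f(v) f(v₊) |v−v₊|^γ ⟨v⟩^{s} ⟨v₊⟩^{s} dv dv₊ < ∞. Set F := f(1−εf). Then 𝒥_{s,1}(f,F) = (1/2)(𝒥_{s,1}(F,F) + 𝒥_{s,1}(f,f)) + (ε/2)(𝒥_{s,1}(f²,f) − 𝒥_{s,1}(f,f²)) − (ε²/2) 𝒥_{s,1}(f²,f²), and moreover 𝒥_{s,1}(f²,f) − 𝒥_{s,1}(f,f²) = 2s ∬_{ℝ³×ℝ³} f(v)² f(v₊) |v−v₊|^{γ+2} (⟨v⟩^{s−2} − ⟨v₊⟩^{s−2}) dv dv₊. (Lemma 3.3 of the paper.) -/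

import Mathlib

open MeasureTheory Real

abbrev E3 := EuclideanSpace ℝ (Fin 3)

noncomputable def jap (v : E3) : ℝ := Real.sqrt (1 + ‖v‖ ^ 2)

/-- `𝒥_{s,1}(h,g)` from the paper. -/
noncomputable def Js1 (γ s : ℝ) (h g : E3 → ℝ) : ℝ :=
  2 * s * ∫ p : E3 × E3, h p.1 * g p.2 * ‖p.1 - p.2‖ ^ γ *
    (jap p.1 ^ (s - 2) - jap p.2 ^ (s - 2)) * (‖p.2‖ ^ 2 - (inner ℝ p.1 p.2 : ℝ))

lemma one_le_jap (v : E3) : 1 ≤ jap v := by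
  unfold jap
  rw [Real.one_le_sqrt]
  nlinarith [sq_nonneg ‖v‖]

lemma norm_le_jap (v : E3) : ‖v‖ ≤ jap v := by
  unfold jap
  apply Real.le_sqrt_of_sq_le
  linarith

lemma measurable_jap : Measurable jap := by
  unfold jap
  fun_prop

lemma weight_bound (s : ℝ) (hs : 2 < s) (v w : E3) :
    |(jap v ^ (s - 2) - jap w ^ (s - 2)) * (‖w‖ ^ 2 - (inner ℝ v w : ℝ))| ≤
      2 * (jap v ^ s * jap w ^ s) := by
  have ha := one_le_jap v
  have hb := one_le_jap w
  have hva := norm_le_jap v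
  have hwb := norm_le_jap w
  have hA : 1 ≤ jap v ^ (s - 2) := Real.one_le_rpow ha (by linarith)
  have hB : 1 ≤ jap w ^ (s - 2) := Real.one_le_rpow hb (by linarith)
  have hAs : jap v ^ s = jap v ^ (s - 2) * jap v ^ 2 := by
    rw [← Real.rpow_natCast, ← Real.rpow_add (by linarith)]
    norm_num
  have hBs : jap w ^ s = jap w ^ (s - 2) * jap w ^ 2 := by
    rw [← Real.rpow_natCast, ← Real.rpow_add (by linarith)]
    norm_num
  rw [hAs, hBs, abs_mul]
  generalize jap v ^ (s - 2) = A at *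
  generalize jap w ^ (s - 2) = B at *
  generalize jap v = a at *
  generalize jap w = b at *
  have h1 : |A - B| ≤ A * B := by
    rw [abs_le]
    constructor <;> nlinarith
  have hin : |(inner ℝ v w : ℝ)| ≤ a * b :=
    (abs_real_inner_le_norm v w).trans
      (mul_le_mul hva hwb (norm_nonneg _) (by linarith))
  have hw2 : ‖w‖ ^ 2 ≤ b ^ 2 := pow_le_pow_left₀ (norm_nonneg _) hwb 2
  have hab : 1 ≤ a * b := one_le_mul_of_one_le_of_one_le ha hb
  have hab2 : a * b ≤ a ^ 2 * b ^ 2 := by nlinarith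
  have hb2 : b ^ 2 ≤ a ^ 2 * b ^ 2 := by
    have : 1 ≤ a ^ 2 := by nlinarith
    nlinarith [sq_nonneg b]
  have h2 : |‖w‖ ^ 2 - (inner ℝ v w : ℝ)| ≤ 2 * (a ^ 2 * b ^ 2) := by
    obtain ⟨h3, h4⟩ := abs_le.mp hin
    rw [abs_le]
    constructor <;> nlinarith [sq_nonneg ‖w‖]
  calc |A - B| * |‖w‖ ^ 2 - (inner ℝ v w : ℝ)| ≤ (A * B) * (2 * (a ^ 2 * b ^ 2)) :=
        mul_le_mul h1 h2 (abs_nonneg _) (by positivity)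
    _ = 2 * (A * a ^ 2 * (B * b ^ 2)) := by ring

/-- The integrand of `Js1`. -/
noncomputable def Jker (γ s : ℝ) (h g : E3 → ℝ) (p : E3 × E3) : ℝ :=
  h p.1 * g p.2 * ‖p.1 - p.2‖ ^ γ *
    (jap p.1 ^ (s - 2) - jap p.2 ^ (s - 2)) * (‖p.2‖ ^ 2 - (inner ℝ p.1 p.2 : ℝ))

lemma Jker_integrable (γ s : ℝ) (hs : 2 < s) (f h g : E3 → ℝ) (C D : ℝ)
    (hC : 0 ≤ C) (hD : 0 ≤ D) (hf0 : ∀ v, 0 ≤ f v) (hh : Measurable h) (hg : Measurable g)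
    (hhf : ∀ v, |h v| ≤ C * f v) (hgf : ∀ v, |g v| ≤ D * f v)
    (hint : Integrable (fun p : E3 × E3 =>
      f p.1 * f p.2 * ‖p.1 - p.2‖ ^ γ * (jap p.1 ^ s * jap p.2 ^ s))) :
    Integrable (Jker γ s h g) := by
  have hj := measurable_jap
  refine (hint.const_mul (2 * C * D)).mono' ?_ ?_
  · apply Measurable.aestronglyMeasurable
    unfold Jker
    fun_prop
  · refine Filter.Eventually.of_forall fun p => ?_
    have hb := weight_bound s hs p.1 p.2
    have hn : 0 ≤ ‖p.1 - p.2‖ ^ γ := Real.rpow_nonneg (norm_nonneg _) _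
    have h1 : |h p.1| * |g p.2| ≤ (C * f p.1) * (D * f p.2) :=
      mul_le_mul (hhf _) (hgf _) (abs_nonneg _) (mul_nonneg hC (hf0 _))
    have h0 : 0 ≤ (C * f p.1) * (D * f p.2) :=
      mul_nonneg (mul_nonneg hC (hf0 _)) (mul_nonneg hD (hf0 _))
    rw [Real.norm_eq_abs]
    unfold Jker
    rw [mul_assoc, abs_mul, abs_mul, abs_mul, abs_of_nonneg hn]
    calc |h p.1| * |g p.2| * ‖p.1 - p.2‖ ^ γ * _
        ≤ (C * f p.1) * (D * f p.2) * ‖p.1 - p.2‖ ^ γ *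
          (2 * (jap p.1 ^ s * jap p.2 ^ s)) :=
          mul_le_mul (mul_le_mul_of_nonneg_right h1 hn) hb (abs_nonneg _) (mul_nonneg h0 hn)
      _ = _ := by ring

lemma Js1_eq (γ s : ℝ) (h g : E3 → ℝ) : Js1 γ s h g = 2 * s * ∫ p, Jker γ s h g p := rfl

/-- Lemma 3.3: decomposition of `𝒥_{s,1}(f,F)` with `F = f(1-εf)`. -/
theorem Js1_decomposition (γ s ε : ℝ) (hγ₁ : -2 < γ) (hγ₂ : γ < 0) (hs : 2 < s)
    (hε : 0 < ε) (f : E3 → ℝ) (hf : Measurable f)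
    (hf0 : ∀ v, 0 ≤ f v) (hfε : ∀ v, f v ≤ ε⁻¹)
    (hint : Integrable (fun p : E3 × E3 =>
      f p.1 * f p.2 * ‖p.1 - p.2‖ ^ γ * (jap p.1 ^ s * jap p.2 ^ s))) :
    Js1 γ s f (fun v => f v * (1 - ε * f v)) =
      (1 / 2) * (Js1 γ s (fun v => f v * (1 - ε * f v)) (fun v => f v * (1 - ε * f v)) +
          Js1 γ s f f) +
        (ε / 2) * (Js1 γ s (fun v => (f v) ^ 2) f - Js1 γ s f (fun v => (f v) ^ 2)) -
        (ε ^ 2 / 2) * Js1 γ s (fun v => (f v) ^ 2) (fun v => (f v) ^ 2) ∧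
    Js1 γ s (fun v => (f v) ^ 2) f - Js1 γ s f (fun v => (f v) ^ 2) =
      2 * s * (∫ p : E3 × E3, (f p.1) ^ 2 * f p.2 * ‖p.1 - p.2‖ ^ (γ + 2) *
        (jap p.1 ^ (s - 2) - jap p.2 ^ (s - 2))) := by
  have hsq : ∀ v, |f v ^ 2| ≤ ε⁻¹ * f v := fun v => by
    rw [abs_of_nonneg (sq_nonneg _), sq]
    exact mul_le_mul_of_nonneg_right (hfε v) (hf0 v)
  have hone : ∀ v, |f v| ≤ 1 * f v := fun v => by
    rw [abs_of_nonneg (hf0 v), one_mul]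
  have hm2 : Measurable (fun v => f v ^ 2) := hf.pow_const 2
  have he : 0 ≤ ε⁻¹ := (inv_pos.mpr hε).le
  have i11 := Jker_integrable γ s hs f f f 1 1 zero_le_one zero_le_one hf0 hf hf hone hone hint
  have i12 := Jker_integrable γ s hs f f _ 1 _ zero_le_one he hf0 hf hm2 hone hsq hint
  have i21 := Jker_integrable γ s hs f _ f _ 1 he zero_le_one hf0 hm2 hf hsq hone hint
  have i22 := Jker_integrable γ s hs f _ _ _ _ he he hf0 hm2 hm2 hsq hsq hint
  constructor
  · have e1 : ∫ p, Jker γ s f (fun v => f v * (1 - ε * f v)) p =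
        (∫ p, Jker γ s f f p) - ε * ∫ p, Jker γ s f (fun v => f v ^ 2) p := by
      rw [← integral_const_mul, ← integral_sub i11 (i12.const_mul _)]
      congr 1
      funext p
      unfold Jker
      ring
    have j1 : Integrable (fun p => Jker γ s f f p - ε * Jker γ s f (fun v => f v ^ 2) p) :=
      i11.sub (i12.const_mul _)
    have j2 : Integrable (fun p => Jker γ s f f p - ε * Jker γ s f (fun v => f v ^ 2) p
        - ε * Jker γ s (fun v => f v ^ 2) f p) :=
      j1.sub (i21.const_mul _)
    have e2 : ∫ p, Jker γ s (fun v => f v * (1 - ε * f v)) (fun v => f v * (1 - ε * f v)) p =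
        (((∫ p, Jker γ s f f p) - ε * ∫ p, Jker γ s f (fun v => f v ^ 2) p)
          - ε * ∫ p, Jker γ s (fun v => f v ^ 2) f p)
          + ε ^ 2 * ∫ p, Jker γ s (fun v => f v ^ 2) (fun v => f v ^ 2) p := by
      rw [← integral_const_mul, ← integral_const_mul, ← integral_const_mul,
        ← integral_sub i11 (i12.const_mul _),
        ← integral_sub j1 (i21.const_mul _),
        ← integral_add j2 (i22.const_mul _)]
      congr 1
      funext p
      unfold Jker
      ring
    simp only [Js1_eq]
    rw [e1, e2]
    ring
  · have hswap : ∫ p, Jker γ s f (fun v => f v ^ 2) p =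
        ∫ p : E3 × E3, Jker γ s f (fun v => f v ^ 2) p.swap :=
      (integral_prod_swap (μ := (volume : Measure E3)) (ν := (volume : Measure E3))
        (Jker γ s f (fun v => f v ^ 2))).symm
    have i12' : Integrable (fun p : E3 × E3 => Jker γ s f (fun v => f v ^ 2) p.swap) :=
      Integrable.swap (μ := (volume : Measure E3)) (ν := (volume : Measure E3)) i12
    simp only [Js1_eq]
    rw [← mul_sub, hswap, ← integral_sub i21 i12']
    congr 2
    funext p
    have hk : ‖p.1 - p.2‖ ^ (γ + 2) = ‖p.1 - p.2‖ ^ γ * ‖p.1 - p.2‖ ^ 2 := by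
      rw [← Real.rpow_natCast, ← Real.rpow_add' (norm_nonneg _)]
      · norm_num
      · push_cast
        linarith
    unfold Jker
    simp only [Prod.fst_swap, Prod.snd_swap]
    rw [hk, norm_sub_rev p.2 p.1, real_inner_comm p.1 p.2, norm_sub_sq_real]
    ring
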